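/- Let M be a countable homogeneous structure with the strong small index property and locally finite algebraicity, and G = Aut(M). Then every abstract group automorphism F of G maps the family SS(M) onto itself: for every subgroup H of G, H ∈ SS(M) if and only if F(H) ∈ SS(M). -/

import Mathlib

open FirstOrder Cardinal

namespace PaperSSIP

variable {L : FirstOrder.Language} {M : Type*} [L.Structure M]

instance autGroup : Group (M ≃[L] M) where
  mul f g := f.comp g
  one := FirstOrder.Language.Equiv.refl L M
  inv := FirstOrder.Language.Equiv.symm
  mul_assoc f g h := by ext x; rfl
  one_mul f := by ext x; rfl
  mul_one f := by ext x; rfl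
  inv_mul_cancel f := by
    ext x
    exact f.symm_apply_apply x

theorem mul_apply (f g : M ≃[L] M) (x : M) : (f * g) x = f (g x) := rfl

theorem one_apply (x : M) : (1 : M ≃[L] M) x = x := rfl

theorem inv_apply (f : M ≃[L] M) (x : M) : f⁻¹ x = f.symm x := rfl

/-- The pointwise stabilizer of a set. -/
def ptStab (L : FirstOrder.Language) {M : Type*} [L.Structure M] (A : Set M) :
    Subgroup (M ≃[L] M) where
  carrier := {g | ∀ a ∈ A, g a = a}
  one_mem' := fun a _ => rfl
  mul_mem' := by
    intro f g hf hg a ha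
    rw [mul_apply, hg a ha, hf a ha]
  inv_mem' := by
    intro f hf a ha
    rw [inv_apply]
    conv_lhs => rw [← hf a ha]
    exact f.symm_apply_apply a

/-- The setwise stabilizer of a set. -/
def setStab (L : FirstOrder.Language) {M : Type*} [L.Structure M] (A : Set M) :
    Subgroup (M ≃[L] M) where
  carrier := {g | g '' A = A}
  one_mem' := by
    have : ⇑(1 : M ≃[L] M) = id := funext fun x => rfl
    simp only [Set.mem_setOf_eq, this, Set.image_id]
  mul_mem' := by
    intro f g hf hg
    have : ⇑(f * g) = ⇑f ∘ ⇑g := rfl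
    simp only [Set.mem_setOf_eq] at *
    rw [this, Set.image_comp, hg, hf]
  inv_mem' := by
    intro f hf
    have h1 : ⇑f⁻¹ ∘ ⇑f = id := funext fun x => f.symm_apply_apply x
    simp only [Set.mem_setOf_eq] at *
    calc ⇑f⁻¹ '' A = ⇑f⁻¹ '' (⇑f '' A) := by rw [hf]
    _ = A := by rw [← Set.image_comp, h1, Set.image_id]

/-- The orbit of a point under a subgroup of the automorphism group. -/
def orbit (H : Subgroup (M ≃[L] M)) (a : M) : Set M := {b | ∃ g ∈ H, g a = b}

/-- The algebraic closure of a set: points with finite orbit under the pointwise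
stabilizer of the set. -/
def acl (L : FirstOrder.Language) {M : Type*} [L.Structure M] (A : Set M) : Set M :=
  {a | (orbit (ptStab L A) a).Finite}

/-- A subgroup has small index if its index is less than the continuum. -/
def SmallIndex (H : Subgroup (M ≃[L] M)) : Prop := #((M ≃[L] M) ⧸ H) < continuum

/-- The strong small index property. -/
def HasSSIP (L : FirstOrder.Language) (M : Type*) [L.Structure M] : Prop :=
  ∀ H : Subgroup (M ≃[L] M), SmallIndex H →
    ∃ A : Set M, A.Finite ∧ ptStab L A ≤ H ∧ H ≤ setStab L A

/-- Locally finite algebraicity. -/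
def LocFinAlg (L : FirstOrder.Language) (M : Type*) [L.Structure M] : Prop :=
  ∀ A : Set M, A.Finite → (acl L A).Finite

/-- Membership in `𝐀(M)`: being (the substructure carried by) the algebraic closure
of a finite set. -/
def memA (L : FirstOrder.Language) {M : Type*} [L.Structure M]
    (S : L.Substructure M) : Prop :=
  ∃ B : Set M, B.Finite ∧ (S : Set M) = acl L B

/-- `G_(K, L')`: automorphisms of `M` whose restriction to `K` lies in `L'`. -/
def stabIn (S : L.Substructure M) (L' : Subgroup (↥S ≃[L] ↥S)) :
    Subgroup (M ≃[L] M) where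
  carrier := {f | ∃ e ∈ L', ∀ x : S, f (x : M) = (e x : M)}
  one_mem' := ⟨1, L'.one_mem, fun _ => rfl⟩
  mul_mem' := by
    rintro f g ⟨ef, hef, hf⟩ ⟨eg, heg, hg⟩
    refine ⟨ef * eg, mul_mem hef heg, fun x => ?_⟩
    rw [mul_apply, hg x]
    exact hf (eg x)
  inv_mem' := by
    rintro f ⟨e, he, hfe⟩
    refine ⟨e⁻¹, inv_mem he, fun x => ?_⟩
    have h1 : f ((e⁻¹ x : S) : M) = (x : M) := by
      rw [hfe (e⁻¹ x)]
      exact congrArg _ (e.apply_symm_apply x)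
    have h2 : f (f⁻¹ (x : M)) = (x : M) := f.apply_symm_apply x
    exact EquivLike.injective f (h2.trans h1.symm)

/-- The family `𝒮𝒮(M)` of subgroups of the form `G_(K, L')`. -/
def SS (L : FirstOrder.Language) (M : Type*) [L.Structure M] :
    Set (Subgroup (M ≃[L] M)) :=
  {H | ∃ (S : L.Substructure M) (L' : Subgroup (↥S ≃[L] ↥S)), memA L S ∧ H = stabIn S L'}

/-- The family `𝒫𝒮(M)` of pointwise stabilizers of members of `𝐀(M)`. -/
def PS (L : FirstOrder.Language) (M : Type*) [L.Structure M] :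
    Set (Subgroup (M ≃[L] M)) :=
  {H | ∃ S : L.Substructure M, memA L S ∧ H = ptStab L (S : Set M)}


theorem subset_acl (A : Set M) : A ⊆ acl L A := by
  intro a ha
  refine (Set.finite_singleton a).subset ?_
  rintro _ ⟨g, hg, rfl⟩
  exact hg a ha

/-- The algebraic closure of a set, as a substructure. -/
def aclSubstructure (L : FirstOrder.Language) {M : Type*} [L.Structure M] (A : Set M) :
    L.Substructure M where
  carrier := acl L A
  fun_mem := by
    intro n f x hx
    have hfin : (Set.univ.pi fun i => orbit (ptStab L A) (x i)).Finite :=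
      Set.Finite.pi' hx |>.subset fun y hy i => hy i (Set.mem_univ i)
    refine (hfin.image (FirstOrder.Language.Structure.funMap f)).subset ?_
    rintro _ ⟨g, hg, rfl⟩
    exact ⟨g ∘ x, fun i _ => ⟨g, hg, rfl⟩, (g.map_fun f x).symm⟩

theorem mem_acl_of_mem_setStab {A : Set M} {g : M ≃[L] M} (hg : g ∈ setStab L A) {a : M}
    (ha : a ∈ acl L A) : g a ∈ acl L A := by
  refine (Set.Finite.image g ha).subset ?_
  rintro _ ⟨k, hk, rfl⟩
  refine ⟨(g⁻¹ * k * g) a, ⟨g⁻¹ * k * g, fun x hx => ?_, rfl⟩, g.apply_symm_apply _⟩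
  have hgx : g x ∈ A := by
    have hA : g '' A = A := hg
    exact hA ▸ Set.mem_image_of_mem g hx
  change g.symm (k (g x)) = x
  rw [hk _ hgx]
  exact g.symm_apply_apply x

/-- The restriction of an automorphism to a substructure that it and its inverse preserve. -/
def restrictEquiv (g : M ≃[L] M) (S : L.Substructure M) (hg : ∀ x ∈ S, g x ∈ S)
    (hg' : ∀ x ∈ S, g⁻¹ x ∈ S) : S ≃[L] S where
  toFun x := ⟨g x, hg x x.2⟩
  invFun x := ⟨g⁻¹ x, hg' x x.2⟩
  left_inv x := Subtype.ext (g.symm_apply_apply x)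
  right_inv x := Subtype.ext (g.apply_symm_apply x)
  map_fun' f x := Subtype.ext (g.map_fun f fun i => (x i : M))
  map_rel' r x := g.map_rel r fun i => (x i : M)

/-- The automorphisms of a substructure induced by the elements of a subgroup. -/
def inducedSubgroup (H : Subgroup (M ≃[L] M)) (S : L.Substructure M) :
    Subgroup (S ≃[L] S) where
  carrier := {e | ∃ h ∈ H, ∀ x : S, h (x : M) = (e x : M)}
  one_mem' := ⟨1, H.one_mem, fun _ => rfl⟩
  mul_mem' := by
    rintro e e' ⟨h, hh, he⟩ ⟨h', hh', he'⟩
    refine ⟨h * h', mul_mem hh hh', fun x => ?_⟩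
    rw [mul_apply, he' x]
    exact he (e' x)
  inv_mem' := by
    rintro e ⟨h, hh, he⟩
    refine ⟨h⁻¹, inv_mem hh, fun x => ?_⟩
    apply EquivLike.injective h
    rw [he (e⁻¹ x)]
    exact (h.apply_symm_apply (x : M)).trans (congrArg _ (e.apply_symm_apply x).symm)

theorem ptStab_le_stabIn (S : L.Substructure M) (L' : Subgroup (S ≃[L] S)) :
    ptStab L (S : Set M) ≤ stabIn S L' :=
  fun _ hg => ⟨1, L'.one_mem, fun x => hg x x.2⟩

theorem smallIndex_of_ptStab_le [Countable M] {A : Set M} (hA : A.Finite)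
    {H : Subgroup (M ≃[L] M)} (h : ptStab L A ≤ H) : SmallIndex H := by
  have := hA.to_subtype
  have hinj : Function.Injective
      fun (q : (M ≃[L] M) ⧸ H) (a : A) => Quotient.out q (a : M) := by
    intro p q hpq
    rw [← QuotientGroup.out_eq' p, ← QuotientGroup.out_eq' q, QuotientGroup.eq]
    refine h fun a ha => ?_
    have := congrFun hpq ⟨a, ha⟩
    change p.out.symm (q.out a) = a
    rw [← show p.out a = q.out a from this]
    exact p.out.symm_apply_apply a
  have := hinj.countable
  exact mk_le_aleph0.trans_lt aleph0_lt_continuum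

theorem SmallIndex.map {H : Subgroup (M ≃[L] M)} (h : SmallIndex H) (F : MulAut (M ≃[L] M)) :
    SmallIndex (H.map F.toMonoidHom) := by
  have e : (M ≃[L] M) ⧸ H ≃ (M ≃[L] M) ⧸ H.map F.toMonoidHom :=
    Quotient.congr F.toEquiv fun a b => by
      rw [QuotientGroup.leftRel_apply, QuotientGroup.leftRel_apply]
      change _ ↔ (F a)⁻¹ * F b ∈ _
      rw [← map_inv, ← map_mul]
      exact (Subgroup.mem_map_iff_mem F.injective).symm
  exact (mk_congr e).symm.trans_lt h

theorem mem_SS_iff_smallIndex [Countable M] (hssip : HasSSIP L M) (hlf : LocFinAlg L M)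
    (H : Subgroup (M ≃[L] M)) : H ∈ SS L M ↔ SmallIndex H := by
  constructor
  · rintro ⟨S, L', ⟨B, hB, hS⟩, rfl⟩
    exact smallIndex_of_ptStab_le (hS ▸ hlf B hB) (ptStab_le_stabIn S L')
  · intro hH
    obtain ⟨A, hA, hpt, hset⟩ := hssip H hH
    let S := aclSubstructure L A
    refine ⟨S, inducedSubgroup H S, ⟨A, hA, rfl⟩, le_antisymm (fun h hh => ?_) ?_⟩
    · exact ⟨restrictEquiv h S (fun _ => mem_acl_of_mem_setStab (hset hh))
        (fun _ => mem_acl_of_mem_setStab (hset (inv_mem hh))), ⟨h, hh, fun _ => rfl⟩,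
        fun _ => rfl⟩
    · rintro f ⟨e, ⟨h, hh, he⟩, hf⟩
      have hmem : h⁻¹ * f ∈ H := hpt fun a ha => by
        rw [mul_apply, hf ⟨a, subset_acl A ha⟩, ← he]
        exact h.symm_apply_apply a
      simpa using mul_mem hh hmem

/-- Every abstract group automorphism of `Aut(M)` maps `𝒮𝒮(M)` onto itself. -/
theorem statement_10 {L : FirstOrder.Language} {M : Type*} [L.Structure M]
    [Countable M] [Countable L.Symbols]
    (hhom : L.IsUltrahomogeneous M) (hssip : HasSSIP L M) (hlf : LocFinAlg L M)
    (F : MulAut (M ≃[L] M)) (H : Subgroup (M ≃[L] M)) :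
    H ∈ SS L M ↔ H.map F.toMonoidHom ∈ SS L M := by
  rw [mem_SS_iff_smallIndex hssip hlf, mem_SS_iff_smallIndex hssip hlf]
  refine ⟨fun h => h.map F, fun h => ?_⟩
  have hmap : (H.map F.toMonoidHom).map (MulEquiv.symm F).toMonoidHom = H := by
    ext x
    simp [Subgroup.mem_map]
  exact hmap ▸ h.map (MulEquiv.symm F)

end PaperSSIP
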